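/- arXiv:1709.02433 — 2 statements merged into one kernel-verified Lean document; each statement's English description precedes it below -/
import Mathlib

section
/- Let p₁, p₂ ∈ ℂ and ω₁, ω₂ > 0. For each ε with 0 < ε < 2π/(ω₁ + ω₂), let c(ε) denote the unique fixed point of the composition R(εω₂, p₂) ∘ R(εω₁, p₁). Then c(ε) tends to the angle-weighted average p = (ω₁·p₁ + ω₂·p₂)/(ω₁ + ω₂) as ε → 0⁺. -/
open Complex Real Filter Topology

/-- Planar rotation by angle `ω` about center `p` in the complex plane. -/
noncomputable def planeRot (ω : ℝ) (p : ℂ) : ℂ → ℂ :=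
  fun z => p + Complex.exp (ω * Complex.I) * (z - p)

/-- The curve `ε ↦ exp (i ε ω)` has derivative `i ω` at `0`. -/
theorem hasDerivAt_exp_mul_I_zero (ω : ℝ) :
    HasDerivAt (fun ε : ℝ => Complex.exp (((ε * ω : ℝ) : ℂ) * Complex.I)) (ω * Complex.I) 0 := by
  have h := ((((hasDerivAt_id (0 : ℝ)).mul_const ω).ofReal_comp).mul_const Complex.I).cexp
  simpa using h

/-- A fixed point of a composition of two rotations solves a linear equation. -/
theorem planeRot_comp_fixed_point {α β : ℝ} {p q z : ℂ}
    (h : (planeRot β q ∘ planeRot α p) z = z) :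
    (Complex.exp (β * Complex.I) * Complex.exp (α * Complex.I) - 1) * z =
      (Complex.exp (β * Complex.I) - 1) * q +
        Complex.exp (β * Complex.I) * (Complex.exp (α * Complex.I) - 1) * p := by
  simp only [Function.comp_apply, planeRot] at h
  linear_combination h

theorem fixed_point_tendsto_weighted_average
    (p₁ p₂ : ℂ) (ω₁ ω₂ : ℝ) (h₁ : 0 < ω₁) (h₂ : 0 < ω₂)
    (c : ℝ → ℂ)
    (hc : ∀ ε : ℝ, 0 < ε → ε < 2 * Real.pi / (ω₁ + ω₂) →
      (planeRot (ε * ω₂) p₂ ∘ planeRot (ε * ω₁) p₁) (c ε) = c ε) :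
    Tendsto c (𝓝[>] (0 : ℝ))
      (𝓝 (((ω₁ : ℂ) * p₁ + (ω₂ : ℂ) * p₂) / ((ω₁ : ℂ) + (ω₂ : ℂ)))) := by
  have hd₁ := hasDerivAt_exp_mul_I_zero ω₁
  have hd₂ := hasDerivAt_exp_mul_I_zero ω₂
  have hsum : (ω₁ : ℂ) + ω₂ ≠ 0 := by exact_mod_cast (add_pos h₁ h₂).ne'
  have hD := ((hd₂.mul hd₁).sub_const 1).tendsto_slope_zero_right
  have hN := (((hd₂.sub_const 1).mul_const p₂).add
    ((hd₂.mul (hd₁.sub_const 1)).mul_const p₁)).tendsto_slope_zero_right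
  simp only [Pi.mul_apply, Pi.add_apply, zero_add, zero_mul, ofReal_zero, Complex.exp_zero,
    sub_self, mul_zero, mul_one, one_mul, add_zero, sub_zero] at hD hN
  have hD0 : (ω₂ : ℂ) * Complex.I + ω₁ * Complex.I ≠ 0 := by
    rw [← add_mul, add_comm]
    exact mul_ne_zero hsum Complex.I_ne_zero
  have hlim : (ω₂ * Complex.I * p₂ + ω₁ * Complex.I * p₁) /
      ((ω₂ : ℂ) * Complex.I + ω₁ * Complex.I) =
      ((ω₁ : ℂ) * p₁ + (ω₂ : ℂ) * p₂) / ((ω₁ : ℂ) + (ω₂ : ℂ)) := by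
    rw [div_eq_div_iff hD0 hsum]
    ring
  rw [← hlim]
  refine (hN.div hD hD0).congr' ?_
  have hpos : 0 < 2 * Real.pi / (ω₁ + ω₂) := by positivity
  filter_upwards [hD.eventually_ne hD0, Ioo_mem_nhdsGT hpos] with ε hne hε
  rw [Pi.div_apply, div_eq_iff hne, ← planeRot_comp_fixed_point (hc ε hε.1 hε.2), mul_smul_comm,
    mul_comm (c ε)]
end

section
/- Let k ≥ 1, let p₁, …, p_k ∈ ℂ be points and ω₁, …, ω_k ≥ 0 be angles with ω := ω₁ + ⋯ + ω_k > 0. For each ε with 0 < ε < 2π/ω, let c(ε) denote the unique fixed point of the ordered composition R(εω_k, p_k) ∘ ⋯ ∘ R(εω₁, p₁). Then c(ε) tends to the center-of-gravity rotation center p = (ω₁·p₁ + ⋯ + ω_k·p_k)/ω as ε → 0⁺. -/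
open Complex Real Filter Topology

theorem hasDerivAt_exp_ofReal_mul_I (ω : ℝ) :
    HasDerivAt (fun ε : ℝ => Complex.exp ((ε * ω : ℝ) * I)) (ω * I) 0 := by
  have h : HasDerivAt (fun ε : ℝ => ((ε * ω : ℝ) : ℂ) * I) (ω * I) 0 := by
    simpa using (((hasDerivAt_id (0 : ℝ)).mul_const ω).ofReal_comp).mul_const I
  simpa using h.cexp

/-- The ordered composition of the scaled rotations is affine, with a translation part that
vanishes at `ε = 0` and has an explicit derivative there. -/
theorem exists_foldl_planeRot_eq (k : ℕ) (p : Fin k → ℂ) (ω : Fin k → ℝ) :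
    ∃ b : ℝ → ℂ,
      (∀ (ε : ℝ) (z : ℂ), Fin.foldl k (fun w i => planeRot (ε * ω i) (p i) w) z =
        Complex.exp ((ε * ∑ i, ω i : ℝ) * I) * z + b ε) ∧
      b 0 = 0 ∧ HasDerivAt b (-(I * ∑ i, (ω i : ℂ) * p i)) 0 := by
  induction k with
  | zero =>
    exact ⟨fun _ => 0, by simp, rfl, by simpa using hasDerivAt_const (0 : ℝ) (0 : ℂ)⟩
  | succ k ih =>
    obtain ⟨b, hb, hb0, hb'⟩ := ih (fun i => p i.castSucc) (fun i => ω i.castSucc)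
    refine ⟨fun ε => p (Fin.last k) +
      Complex.exp ((ε * ω (Fin.last k) : ℝ) * I) * (b ε - p (Fin.last k)), ?_, ?_, ?_⟩
    · intro ε z
      rw [Fin.foldl_succ_last, hb, Fin.sum_univ_castSucc, mul_add, ofReal_add, add_mul,
        Complex.exp_add, planeRot]
      ring
    · simp [hb0]
    · have h := ((hasDerivAt_exp_ofReal_mul_I (ω (Fin.last k))).mul
        (hb'.sub_const (p (Fin.last k)))).const_add (p (Fin.last k))
      refine h.congr_deriv ?_
      rw [Fin.sum_univ_castSucc]
      simp only [hb0, zero_mul, ofReal_zero, Complex.exp_zero]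
      ring

theorem fixed_point_tendsto_center_of_gravity
    (k : ℕ) (hk : 1 ≤ k) (p : Fin k → ℂ) (ω : Fin k → ℝ)
    (hω : ∀ i, 0 ≤ ω i) (hsum : 0 < ∑ i, ω i)
    (c : ℝ → ℂ)
    (hc : ∀ ε : ℝ, 0 < ε → ε < 2 * Real.pi / (∑ i, ω i) →
      Fin.foldl k (fun w i => planeRot (ε * ω i) (p i) w) (c ε) = c ε) :
    Tendsto c (𝓝[>] (0 : ℝ))
      (𝓝 ((∑ i, (ω i : ℂ) * p i) / ((∑ i, ω i : ℝ) : ℂ))) := by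
  obtain ⟨b, hb, hb0, hb'⟩ := exists_foldl_planeRot_eq k p ω
  set W : ℝ := ∑ i, ω i with hW
  have hWC : (W : ℂ) ≠ 0 := ofReal_ne_zero.mpr hsum.ne'
  have hle : 𝓝[>] (0 : ℝ) ≤ 𝓝[≠] 0 := nhdsWithin_mono _ fun x hx => ne_of_gt hx
  have hB := hb'.tendsto_slope_zero.mono_left hle
  have hA := ((hasDerivAt_exp_ofReal_mul_I W).const_sub 1).tendsto_slope_zero.mono_left hle
  have hne : -((W : ℂ) * I) ≠ 0 := neg_ne_zero.mpr (mul_ne_zero hWC I_ne_zero)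
  have hlim : -(I * ∑ i, (ω i : ℂ) * p i) / -((W : ℂ) * I) =
      (∑ i, (ω i : ℂ) * p i) / (W : ℂ) := by
    rw [neg_div_neg_eq, mul_comm I, mul_div_mul_right _ _ I_ne_zero]
  rw [← hlim]
  refine (hB.div hA hne).congr' ?_
  have hsmall : ∀ᶠ ε in 𝓝[>] (0 : ℝ), ε < 2 * Real.pi / W :=
    nhdsWithin_le_nhds (eventually_lt_nhds (div_pos Real.two_pi_pos hsum))
  filter_upwards [self_mem_nhdsWithin, hsmall, hA.eventually_ne hne] with ε hε hlt hε_ne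
  have hfix := hc ε hε hlt
  rw [hb] at hfix
  rw [Pi.div_apply, div_eq_iff hε_ne]
  simp only [zero_add, hb0, zero_mul, ofReal_zero, Complex.exp_zero, sub_self, sub_zero,
    Complex.real_smul]
  linear_combination ((ε⁻¹ : ℝ) : ℂ) * hfix
end
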